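/- arXiv:1501.00466 — 2 statements merged into one kernel-verified Lean document; each statement's English description precedes it below -/
import Mathlib

section
/- Let f : [0,1] → ℝ satisfy f(0) = 0 and suppose that for every partition 0 = x_0 < x_1 < ... < x_m = 1 we have Σ_{i=1}^m (f(x_i) − f(x_{i-1}))² / (x_i − x_{i-1}) ≤ 1. Then f is absolutely continuous and ∫_0^1 (f'(x))² dx ≤ 1. -/
open MeasureTheory intervalIntegral

open Set Filter Topology

/-- The increments of a monotone function over disjoint subintervals of `[p, q]` sum to at most its
total increment. -/
theorem MonotoneOn.sum_sub_le_sub_of_pairwiseDisjoint {ι : Type*} {V : ℝ → ℝ} {p q : ℝ}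
    (hV : MonotoneOn V (Icc p q)) (hpq : p ≤ q) (s : Finset ι) (l r : ι → ℝ)
    (hlr : ∀ i ∈ s, p ≤ l i ∧ l i < r i ∧ r i ≤ q)
    (hd : (s : Set ι).PairwiseDisjoint fun i => Ioc (l i) (r i)) :
    ∑ i ∈ s, (V (r i) - V (l i)) ≤ V q - V p := by
  classical
  induction s using Finset.induction_on_max_value r generalizing q with
  | empty => simpa using hV ⟨le_rfl, hpq⟩ ⟨hpq, le_rfl⟩ hpq
  | insert i s his hmax ih =>
    obtain ⟨hpl, hlri, hrq⟩ := hlr i (Finset.mem_insert_self i s)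
    rw [Finset.sum_insert his]
    have hleft : ∑ j ∈ s, (V (r j) - V (l j)) ≤ V (l i) - V p := by
      refine ih (hV.mono (Icc_subset_Icc_right (by linarith))) hpl (fun j hj => ?_)
        (hd.subset (by simp))
      obtain ⟨h1, h2, -⟩ := hlr j (Finset.mem_insert_of_mem hj)
      refine ⟨h1, h2, ?_⟩
      by_contra! hlt
      exact Set.disjoint_left.1 (hd (Finset.mem_insert_of_mem hj) (Finset.mem_insert_self i s)
        (by rintro rfl; exact his hj)) ⟨h2, le_rfl⟩ ⟨hlt, hmax j hj⟩
    have : V (r i) ≤ V q := hV ⟨by linarith, hrq⟩ ⟨hpq, le_rfl⟩ hrq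
    linarith

/-- A function whose squared increments are controlled by those of a monotone function times the
length of the interval is absolutely continuous. -/
theorem AbsolutelyContinuousOnInterval.of_sq_sub_le {f V : ℝ → ℝ} {p q : ℝ} (hpq : p ≤ q)
    (hV : MonotoneOn V (Icc p q))
    (hfV : ∀ x ∈ Icc p q, ∀ y ∈ Icc p q, x < y → (f y - f x) ^ 2 ≤ (V y - V x) * (y - x)) :
    AbsolutelyContinuousOnInterval f p q := by
  rw [absolutelyContinuousOnInterval_iff]
  intro ε hε
  have hK : 0 ≤ V q - V p := sub_nonneg.2 (hV ⟨le_rfl, hpq⟩ ⟨hpq, le_rfl⟩ hpq)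
  refine ⟨ε ^ 2 / (V q - V p + 1), by positivity, ?_⟩
  rintro ⟨n, I⟩ ⟨hI, hd⟩ hlen
  simp only [uIcc_of_le hpq] at hI
  set l : ℕ → ℝ := fun i => min (I i).1 (I i).2
  set r : ℕ → ℝ := fun i => max (I i).1 (I i).2
  have hlr (i : ℕ) : l i ≤ r i := min_le_max
  have hl (i : ℕ) (hi : i ∈ Finset.range n) : l i ∈ Icc p q :=
    ⟨le_min (hI i hi).1.1 (hI i hi).2.1, min_le_of_left_le (hI i hi).1.2⟩
  have hr (i : ℕ) (hi : i ∈ Finset.range n) : r i ∈ Icc p q :=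
    ⟨le_max_of_le_left (hI i hi).1.1, max_le (hI i hi).1.2 (hI i hi).2.2⟩
  have hdist (i : ℕ) : dist (I i).1 (I i).2 = r i - l i := by
    rw [Real.dist_eq, ← max_sub_min_eq_abs']
  have hdistf (i : ℕ) : dist (f (I i).1) (f (I i).2) = |f (r i) - f (l i)| := by
    rcases le_total (I i).1 (I i).2 with h | h <;> simp [l, r, h, Real.dist_eq, abs_sub_comm]
  simp only [hdist, hdistf] at hlen ⊢
  have hVsum : ∑ i ∈ Finset.range n, (V (r i) - V (l i)) ≤ V q - V p := by
    rw [← Finset.sum_filter_of_ne (p := fun i => l i < r i)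
      fun i _ h => (hlr i).lt_of_ne fun h' => h (by rw [h', sub_self])]
    refine hV.sum_sub_le_sub_of_pairwiseDisjoint hpq _ l r (fun i hi => ?_)
      (hd.subset (Finset.coe_subset.2 (Finset.filter_subset _ _)))
    rw [Finset.mem_filter] at hi
    exact ⟨(hl i hi.1).1, hi.2, (hr i hi.1).2⟩
  have hsq : (∑ i ∈ Finset.range n, |f (r i) - f (l i)|) ^ 2 ≤
      (∑ i ∈ Finset.range n, (V (r i) - V (l i))) * ∑ i ∈ Finset.range n, (r i - l i) := by
    refine Finset.sum_sq_le_sum_mul_sum_of_sq_le_mul _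
      (fun i hi => sub_nonneg.2 (hV (hl i hi) (hr i hi) (hlr i)))
      (fun i _ => sub_nonneg.2 (hlr i)) fun i hi => ?_
    rw [sq_abs]
    rcases (hlr i).lt_or_eq with h | h
    · exact hfV _ (hl i hi) _ (hr i hi) h
    · simp [h]
  have hlen0 : 0 ≤ ∑ i ∈ Finset.range n, (r i - l i) :=
    Finset.sum_nonneg fun i _ => sub_nonneg.2 (hlr i)
  refine lt_of_pow_lt_pow_left₀ 2 hε.le (hsq.trans_lt ?_)
  rw [lt_div_iff₀ (by positivity)] at hlen
  have := mul_le_mul_of_nonneg_right hVsum hlen0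
  nlinarith

/-- If the squared increments of `f` are controlled by those of `V` times the length of the
interval, then `(f')² ≤ V'`. -/
theorem HasDerivAt.sq_le_of_sq_sub_le {f V : ℝ → ℝ} {f' V' x q : ℝ} (hf : HasDerivAt f f' x)
    (hV : HasDerivAt V V' x) (hxq : x < q)
    (hfV : ∀ y ∈ Ioo x q, (f y - f x) ^ 2 ≤ (V y - V x) * (y - x)) : f' ^ 2 ≤ V' := by
  refine le_of_tendsto_of_tendsto ((hasDerivAt_iff_tendsto_slope_left_right.1 hf).2.pow 2)
    (hasDerivAt_iff_tendsto_slope_left_right.1 hV).2 ?_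
  filter_upwards [Ioo_mem_nhdsGT hxq] with y hy
  have hpos : 0 < y - x := sub_pos.2 hy.1
  rw [slope_def_field, slope_def_field, div_pow, div_le_div_iff₀ (by positivity) hpos]
  nlinarith [mul_le_mul_of_nonneg_right (hfV y hy) hpos.le]

/-- The sums `Σ (f(x_i) − f(x_{i-1}))² / (x_i − x_{i-1})` over all partitions of `[0, c]`. -/
def partitionSums (f : ℝ → ℝ) (c : ℝ) : Set ℝ :=
  {S | ∃ (m : ℕ) (x : ℕ → ℝ), x 0 = 0 ∧ x m = c ∧ (∀ i < m, x i < x (i + 1)) ∧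
    ∑ i ∈ Finset.range m, (f (x (i + 1)) - f (x i)) ^ 2 / (x (i + 1) - x i) = S}

theorem zero_mem_partitionSums (f : ℝ → ℝ) : 0 ∈ partitionSums f 0 :=
  ⟨0, fun _ => 0, by simp⟩

theorem add_mem_partitionSums {f : ℝ → ℝ} {c d S : ℝ} (hcd : c < d) (hS : S ∈ partitionSums f c) :
    S + (f d - f c) ^ 2 / (d - c) ∈ partitionSums f d := by
  obtain ⟨m, x, h0, hm, hx, rfl⟩ := hS
  refine ⟨m + 1, fun i => if i ≤ m then x i else d, by simpa, by simp, fun i hi => ?_, ?_⟩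
  · rcases (Nat.lt_succ_iff.1 hi).lt_or_eq with h | rfl
    · simpa [h.le, Nat.succ_le_iff.2 h] using hx i h
    · simpa [hm]
  · rw [Finset.sum_range_succ]
    congr 1
    · refine Finset.sum_congr rfl fun i hi => ?_
      have := Finset.mem_range.1 hi
      simp [this.le, Nat.succ_le_iff.2 this]
    · simp [hm]

theorem exists_monotoneOn_of_partitionSums_le {f : ℝ → ℝ} {K q : ℝ} (hq : 0 ≤ q)
    (h : ∀ S ∈ partitionSums f q, S ≤ K) :
    ∃ V : ℝ → ℝ, MonotoneOn V (Icc 0 q) ∧ V q - V 0 ≤ K ∧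
      ∀ x ∈ Icc 0 q, ∀ y ∈ Icc 0 q, x < y → (f y - f x) ^ 2 ≤ (V y - V x) * (y - x) := by
  have hne : ∀ c ∈ Icc 0 q, (partitionSums f c).Nonempty := by
    intro c hc
    rcases hc.1.eq_or_lt with rfl | hc
    · exact ⟨0, zero_mem_partitionSums f⟩
    · exact ⟨_, add_mem_partitionSums hc (zero_mem_partitionSums f)⟩
  have hbdd : ∀ c ∈ Icc 0 q, BddAbove (partitionSums f c) := by
    refine fun c hc => ⟨K, fun S hS => ?_⟩
    rcases hc.2.eq_or_lt with rfl | hc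
    · exact h S hS
    · have := h _ (add_mem_partitionSums hc hS)
      have : 0 ≤ (f q - f c) ^ 2 / (q - c) := div_nonneg (sq_nonneg _) (sub_nonneg.2 hc.le)
      linarith
  have hstep : ∀ x ∈ Icc 0 q, ∀ y ∈ Icc 0 q, x < y →
      (f y - f x) ^ 2 / (y - x) ≤ sSup (partitionSums f y) - sSup (partitionSums f x) := by
    intro x hx y hy hxy
    rw [le_sub_comm]
    exact csSup_le (hne x hx) fun S hS => le_sub_iff_add_le.2
      (le_csSup (hbdd y hy) (add_mem_partitionSums hxy hS))
  refine ⟨fun c => sSup (partitionSums f c), fun x hx y hy hxy => ?_, ?_, fun x hx y hy hxy => ?_⟩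
  · rcases hxy.eq_or_lt with rfl | hxy
    · exact le_rfl
    · exact sub_nonneg.1
        ((div_nonneg (sq_nonneg _) (sub_nonneg.2 hxy.le)).trans (hstep x hx y hy hxy))
  · have h1 := csSup_le (hne q ⟨hq, le_rfl⟩) h
    have h2 := le_csSup (hbdd 0 ⟨le_rfl, hq⟩) (zero_mem_partitionSums f)
    dsimp only
    linarith
  · exact (div_le_iff₀ (sub_pos.2 hxy)).1 (hstep x hx y hy hxy)

/-- If `f(0) = 0` and for every partition `0 = x_0 < x_1 < ... < x_m = 1` we have
`Σ (f(x_i) − f(x_{i-1}))²/(x_i − x_{i-1}) ≤ 1`, then `f` is absolutely continuous on `[0,1]`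
(i.e. `f x = ∫_0^x g` for an integrable density `g = f'`) with `∫_0^1 (f')² ≤ 1`. -/
theorem strassen_class_of_partition_sums (f : ℝ → ℝ) (hf0 : f 0 = 0)
    (h : ∀ (m : ℕ), 1 ≤ m → ∀ x : ℕ → ℝ, x 0 = 0 → x m = 1 →
      (∀ i < m, x i < x (i+1)) →
      ∑ i ∈ Finset.range m, (f (x (i+1)) - f (x i))^2 / (x (i+1) - x i) ≤ 1) :
    ∃ g : ℝ → ℝ, IntervalIntegrable g volume 0 1 ∧
      IntervalIntegrable (fun t => (g t)^2) volume 0 1 ∧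
      (∀ x ∈ Set.Icc (0:ℝ) 1, f x = ∫ t in (0:ℝ)..x, g t) ∧
      (∫ t in (0:ℝ)..1, (g t)^2) ≤ 1 := by
  obtain ⟨V, hVmono, hV1, hfV⟩ :=
    exists_monotoneOn_of_partitionSums_le (f := f) (K := 1) zero_le_one (by
      rintro S ⟨m, x, h0, hm, hx, rfl⟩
      refine h m (Nat.one_le_iff_ne_zero.2 ?_) x h0 hm hx
      rintro rfl
      exact zero_ne_one (h0.symm.trans hm))
  have hac := AbsolutelyContinuousOnInterval.of_sq_sub_le zero_le_one hVmono hfV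
  have hVmono' : MonotoneOn V (uIcc 0 1) := by rwa [uIcc_of_le zero_le_one]
  have hVint := hVmono'.intervalIntegrable_deriv
  have hle : ∀ᵐ x, x ∈ Ioo (0 : ℝ) 1 → (deriv f x) ^ 2 ≤ deriv V x := by
    filter_upwards [hac.ae_differentiableAt, hVmono.ae_differentiableWithinAt_of_mem]
      with x hfx hVx hx
    have hx' : x ∈ Icc (0 : ℝ) 1 := Ioo_subset_Icc_self hx
    refine (hfx (by rwa [uIcc_of_le zero_le_one])).hasDerivAt.sq_le_of_sq_sub_le
      ((hVx hx').differentiableAt (Icc_mem_nhds hx.1 hx.2)).hasDerivAt hx.2 fun y hy => ?_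
    exact hfV x hx' y ⟨(hx.1.trans hy.1).le, hy.2.le⟩ hy.1
  have hle' : ∀ᵐ x ∂volume.restrict (Ioc (0 : ℝ) 1), (deriv f x) ^ 2 ≤ deriv V x := by
    rw [← restrict_Ioo_eq_restrict_Ioc]
    exact (ae_restrict_iff' measurableSet_Ioo).2 hle
  have hsq : IntervalIntegrable (fun t => (deriv f t) ^ 2) volume 0 1 := by
    refine hVint.mono_fun' ((measurable_deriv f).pow_const 2).aestronglyMeasurable ?_
    rw [uIoc_of_le zero_le_one]
    filter_upwards [hle'] with x hx
    rwa [Real.norm_of_nonneg (sq_nonneg _)]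
  refine ⟨deriv f, hac.intervalIntegrable_deriv, hsq, fun x hx => ?_, ?_⟩
  · have hsub : uIcc 0 x ⊆ uIcc (0 : ℝ) 1 := by
      rw [uIcc_of_le hx.1, uIcc_of_le zero_le_one]
      exact Icc_subset_Icc_right hx.2
    rw [(hac.mono hsub).integral_deriv_eq_sub, hf0, sub_zero]
  · have hV01 : 0 ≤ V 1 - V 0 :=
      sub_nonneg.2 (hVmono ⟨le_rfl, zero_le_one⟩ ⟨zero_le_one, le_rfl⟩ zero_le_one)
    have hV' := hVmono'.intervalIntegral_deriv_mem_uIcc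
    rw [uIcc_of_le hV01] at hV'
    calc ∫ t in (0:ℝ)..1, (deriv f t) ^ 2 ≤ ∫ t in (0:ℝ)..1, deriv V t := by
          rw [integral_of_le zero_le_one, integral_of_le zero_le_one]
          exact integral_mono_ae hsq.1 hVint.1 hle'
      _ ≤ V 1 - V 0 := hV'.2
      _ ≤ 1 := hV1
end

section
/- Fix an integer m ≥ 1 and a real x. For each N, place n(N) = ⌊N·log N + (m−1)·N·log log N + N·x⌋ balls independently and uniformly at random into N urns. Then the probability that every urn contains at least m balls converges, as N → ∞, to exp(−exp(−x)/(m−1)!). -/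
open Filter

/-- The number of balls `⌊N log N + (m−1) N log log N + N x⌋` in the Erdős–Rényi
coupon collector theorem. -/
noncomputable def erBalls (m : ℕ) (x : ℝ) (N : ℕ) : ℕ :=
  ⌊(N : ℝ) * Real.log N + ((m : ℝ) - 1) * N * Real.log (Real.log N) + N * x⌋₊

open PowerSeries in
theorem PowerSeries.derivative_finsetProd {ι R : Type*} [CommSemiring R] [DecidableEq ι]
    (s : Finset ι) (G : ι → R⟦X⟧) :
    d⁄dX R (∏ u ∈ s, G u) = ∑ u ∈ s, ∏ v ∈ s, Function.update G u (d⁄dX R (G u)) v := by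
  induction s using Finset.induction_on with
  | empty => simp
  | insert a s ha ih =>
    rw [Finset.prod_insert ha, Derivation.leibniz, ih, Finset.sum_insert ha,
      Finset.prod_insert ha, Function.update_self, Finset.prod_update_of_notMem ha, add_comm,
      smul_eq_mul, smul_eq_mul, mul_comm, Finset.mul_sum]
    congr 1
    refine Finset.sum_congr rfl fun u hu => ?_
    rw [Finset.prod_insert ha, Function.update_of_ne (by rintro rfl; exact ha hu)]

open PowerSeries in
/-- The exponential formula for allocations: summing over all maps `Fin n → ι` a product of
weights depending on the fibre sizes amounts to extracting a coefficient of the product of the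
exponential generating functions of the weights. -/
theorem PowerSeries.factorial_mul_coeff_prod {ι R : Type*} [CommSemiring R] [Fintype ι]
    [DecidableEq ι] (n : ℕ) (G : ι → R⟦X⟧) :
    (n.factorial : R) * coeff n (∏ u, G u) =
      ∑ f : Fin n → ι, ∏ u, (((Finset.univ.filter (fun t => f t = u)).card.factorial : R) *
        coeff (Finset.univ.filter (fun t => f t = u)).card (G u)) := by
  have step (k : ℕ) (H : R⟦X⟧) : ((k + 1).factorial : R) * coeff (k + 1) H =
      k.factorial * coeff k (d⁄dX R H) := by
    rw [coeff_derivative, Nat.factorial_succ]; push_cast; ring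
  induction n generalizing G with
  | zero => simp [map_prod]
  | succ n ih =>
    rw [step, derivative_finsetProd, map_sum, Finset.mul_sum,
      ← (Fin.consEquiv (fun _ => ι)).sum_comp, Fintype.sum_prod_type]
    refine Finset.sum_congr rfl fun u₀ _ => ?_
    rw [ih]
    refine Finset.sum_congr rfl fun f _ => Finset.prod_congr rfl fun u _ => ?_
    simp only [Fin.consEquiv_apply, Fin.card_filter_univ_succ', Fin.cons_zero,
      Fin.cons_succ]
    by_cases h : u₀ = u
    · subst h
      rw [if_pos rfl, add_comm 1, step, Function.update_self]
    · rw [if_neg h, zero_add, Function.update_of_ne (Ne.symm h)]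

/-- `truncExp m = ∑_{i < m} X ^ i / i!`. -/
noncomputable def truncExp (m : ℕ) : Polynomial ℝ := PowerSeries.trunc m (PowerSeries.exp ℝ)

theorem coeff_truncExp (m i : ℕ) :
    (truncExp m).coeff i = if i < m then (i.factorial : ℝ)⁻¹ else 0 := by
  simp [truncExp, PowerSeries.coeff_trunc]

theorem eval_truncExp (m : ℕ) (a : ℝ) :
    (truncExp m).eval a = ∑ i ∈ Finset.range m, a ^ i / i.factorial := by
  rw [truncExp, ← Polynomial.eval₂_id, PowerSeries.eval₂_trunc_eq_sum_range]
  simp [div_eq_inv_mul]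

theorem coeff_truncExp_pow_nonneg (m k j : ℕ) : 0 ≤ ((truncExp m) ^ k).coeff j := by
  induction k generalizing j with
  | zero => rw [pow_zero, Polynomial.coeff_one]; positivity
  | succ k ih =>
    rw [pow_succ, Polynomial.coeff_mul]
    refine Finset.sum_nonneg fun p _ => mul_nonneg (ih _) ?_
    rw [coeff_truncExp]; positivity

theorem natDegree_truncExp_pow_le (m k : ℕ) : ((truncExp m) ^ k).natDegree ≤ k * m :=
  Polynomial.natDegree_pow_le_of_le k <| Polynomial.natDegree_le_iff_coeff_eq_zero.2 fun i hi => by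
    rw [coeff_truncExp, if_neg (by omega)]

open Classical PowerSeries in
/-- The number of allocations of `n` balls to `N` urns with at least `m` balls in each urn, as a
coefficient of an exponential generating function. -/
theorem card_allocations_eq (m n N : ℕ) :
    ((Finset.univ.filter (fun f : Fin n → Fin N =>
        ∀ u : Fin N, m ≤ (Finset.univ.filter (fun t => f t = u)).card)).card : ℝ) =
      n.factorial * coeff n ((PowerSeries.exp ℝ - (truncExp m : ℝ⟦X⟧)) ^ N) := by
  have h := factorial_mul_coeff_prod n (fun _ : Fin N => PowerSeries.exp ℝ - (truncExp m : ℝ⟦X⟧))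
  rw [Finset.prod_const, Finset.card_univ, Fintype.card_fin] at h
  rw [h, Finset.card_filter, Nat.cast_sum]
  refine Finset.sum_congr rfl fun f _ => ?_
  have h1 (c : ℕ) : (c.factorial : ℝ) * coeff c (PowerSeries.exp ℝ - (truncExp m : ℝ⟦X⟧)) =
      if m ≤ c then 1 else 0 := by
    rw [map_sub, Polynomial.coeff_coe, coeff_truncExp]
    have := Nat.factorial_ne_zero c
    split_ifs <;> first | omega | simp [this]
  simp only [h1]
  rw [Finset.prod_ite_zero]
  simp

/-- The `k`-th term of the inclusion-exclusion formula for the probability that each of `N` urns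
receives at least `m` of `n` balls. -/
noncomputable def sieveTerm (m n N k : ℕ) : ℝ :=
  N.choose k * ∑ j ∈ Finset.range (k * m + 1),
    ((truncExp m) ^ k).coeff j * n.descFactorial j * ((N : ℝ) - k) ^ (n - j) / (N : ℝ) ^ n

open PowerSeries in
theorem factorial_mul_coeff_mul_exp_pow (P : Polynomial ℝ) (n M : ℕ) {d : ℕ} (hd : P.natDegree ≤ d) :
    (n.factorial : ℝ) * coeff n ((P : ℝ⟦X⟧) * PowerSeries.exp ℝ ^ M) =
      ∑ j ∈ Finset.range (d + 1), P.coeff j * n.descFactorial j * (M : ℝ) ^ (n - j) := by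
  rw [PowerSeries.exp_pow_eq_rescale_exp, coeff_mul,
    Finset.Nat.sum_antidiagonal_eq_sum_range_succ_mk, Finset.mul_sum]
  have h1 (j : ℕ) (hj : j ∉ Finset.range (n + 1)) :
      P.coeff j * n.descFactorial j * (M : ℝ) ^ (n - j) = 0 := by
    rw [Nat.descFactorial_of_lt (by rw [Finset.mem_range] at hj; omega)]; simp
  have h2 (j : ℕ) (hj : j ∉ Finset.range (d + 1)) :
      P.coeff j * n.descFactorial j * (M : ℝ) ^ (n - j) = 0 := by
    rw [Polynomial.coeff_eq_zero_of_natDegree_lt]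
    · simp
    · rw [Finset.mem_range] at hj; omega
  have e : ∑ j ∈ Finset.range (d + 1), P.coeff j * n.descFactorial j * (M : ℝ) ^ (n - j) =
      ∑ j ∈ Finset.range (n + 1), P.coeff j * n.descFactorial j * (M : ℝ) ^ (n - j) := by
    rcases le_total d n with h | h
    · exact Finset.sum_subset (Finset.range_mono (by omega)) fun j _ hj => h2 j hj
    · exact (Finset.sum_subset (Finset.range_mono (by omega)) fun j _ hj => h1 j hj).symm
  rw [e]
  refine Finset.sum_congr rfl fun j hj => ?_
  have hj' : j ≤ n := by simpa [Nat.lt_succ_iff] using hj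
  simp only [Polynomial.coeff_coe, coeff_rescale, coeff_exp]
  rw [← Nat.factorial_mul_descFactorial hj']
  have := Nat.factorial_ne_zero (n - j)
  push_cast
  field_simp

open Classical in
open PowerSeries in
/-- Inclusion-exclusion for the probability that every urn receives at least `m` balls. -/
theorem card_allocations_div_eq_tsum (m n N : ℕ) :
    ((Finset.univ.filter (fun f : Fin n → Fin N =>
        ∀ u : Fin N, m ≤ (Finset.univ.filter (fun t => f t = u)).card)).card : ℝ) / (N : ℝ) ^ n =
      ∑' k : ℕ, (-1) ^ k * sieveTerm m n N k := by
  rw [tsum_eq_sum (s := Finset.range (N + 1)) fun k hk => by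
      rw [sieveTerm, Nat.choose_eq_zero_of_lt (by rw [Finset.mem_range] at hk; omega)]; simp,
    card_allocations_eq, sub_eq_neg_add, add_pow, map_sum, Finset.mul_sum, Finset.sum_div]
  refine Finset.sum_congr rfl fun k hk => ?_
  have hk' : k ≤ N := by simpa [Nat.lt_succ_iff] using hk
  have h := factorial_mul_coeff_mul_exp_pow ((truncExp m) ^ k) n (N - k)
    (natDegree_truncExp_pow_le m k)
  rw [Nat.cast_sub hk'] at h
  rw [sieveTerm, ← Finset.sum_div, ← h]
  have e : (-(truncExp m : ℝ⟦X⟧)) ^ k * PowerSeries.exp ℝ ^ (N - k) * (N.choose k : ℝ⟦X⟧) =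
      PowerSeries.C ((-1) ^ k * N.choose k : ℝ) *
        (((truncExp m ^ k : Polynomial ℝ) : ℝ⟦X⟧) * PowerSeries.exp ℝ ^ (N - k)) := by
    rw [neg_pow]; simp; ring
  rw [e, coeff_C_mul]
  ring

theorem eval_mul_pow_truncExp (m k : ℕ) (a w : ℝ) :
    ∑ j ∈ Finset.range (k * m + 1), ((truncExp m) ^ k).coeff j * a ^ j * w ^ k =
      (w * (truncExp m).eval a) ^ k := by
  rw [← Finset.sum_mul, ← Polynomial.eval_eq_sum_range' (Nat.lt_succ_of_le
    (natDegree_truncExp_pow_le m k)), Polynomial.eval_pow, mul_pow, mul_comm]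

theorem sieveTerm_nonneg (m n N k : ℕ) : 0 ≤ sieveTerm m n N k := by
  rcases le_or_gt k N with h | h
  · have : (0 : ℝ) ≤ (N : ℝ) - k := sub_nonneg.2 (by exact_mod_cast h)
    refine mul_nonneg (by positivity) (Finset.sum_nonneg fun j _ => ?_)
    have := coeff_truncExp_pow_nonneg m k j
    positivity
  · simp [sieveTerm, Nat.choose_eq_zero_of_lt h]

theorem sub_pow_div_pow_eq {n N k j : ℕ} (hN : 0 < N) (hj : j ≤ n) :
    ((N : ℝ) - k) ^ (n - j) / (N : ℝ) ^ n = (1 - (k : ℝ) / N) ^ (n - j) / (N : ℝ) ^ j := by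
  have hN' : (N : ℝ) ≠ 0 := by positivity
  obtain ⟨d, rfl⟩ := Nat.exists_eq_add_of_le hj
  rw [Nat.add_sub_cancel_left, one_sub_div hN', div_pow, pow_add]
  field_simp

theorem sieveTerm_le {m n N k : ℕ} (hN : 0 < N) :
    sieveTerm m n N k ≤
      (Real.exp m * (N * Real.exp (-((n : ℝ) / N)) * (truncExp m).eval ((n : ℝ) / N))) ^ k /
        k.factorial := by
  have hN' : (0 : ℝ) < N := by exact_mod_cast hN
  rcases lt_or_ge N k with h | h
  · rw [sieveTerm, Nat.choose_eq_zero_of_lt h, Nat.cast_zero, zero_mul, eval_truncExp]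
    positivity
  have hk : (k : ℝ) ≤ N := by exact_mod_cast h
  rw [← mul_assoc, ← eval_mul_pow_truncExp, sieveTerm]
  calc _ ≤ (N : ℝ) ^ k / k.factorial * ∑ j ∈ Finset.range (k * m + 1),
        ((truncExp m) ^ k).coeff j * ((n : ℝ) / N) ^ j *
          (Real.exp (-((n : ℝ) / N)) * Real.exp m) ^ k := by
        refine mul_le_mul (Nat.choose_le_pow_div k N) (Finset.sum_le_sum fun j hj => ?_) ?_
          (by positivity)
        · have hc := coeff_truncExp_pow_nonneg m k j
          rcases lt_or_ge n j with hnj | hnj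
          · rw [Nat.descFactorial_of_lt hnj, Nat.cast_zero, mul_zero, zero_mul, zero_div]
            positivity
          have hjk : j ≤ k * m := by rw [Finset.mem_range] at hj; omega
          have hjk' : (j : ℝ) ≤ k * m := by exact_mod_cast hjk
          rw [mul_div_assoc, sub_pow_div_pow_eq hN hnj]
          have h0 : (0 : ℝ) ≤ 1 - (k : ℝ) / N := sub_nonneg.2 ((div_le_one hN').2 hk)
          have h1 : (1 - (k : ℝ) / N) ^ (n - j) ≤
              (Real.exp (-((n : ℝ) / N)) * Real.exp m) ^ k := by
            calc (1 - (k : ℝ) / N) ^ (n - j) ≤ Real.exp (-((k : ℝ) / N)) ^ (n - j) :=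
                  pow_le_pow_left₀ h0 (Real.one_sub_le_exp_neg _) _
              _ ≤ _ := by
                  rw [← Real.exp_add, ← Real.exp_nat_mul, ← Real.exp_nat_mul, Real.exp_le_exp,
                    Nat.cast_sub hnj]
                  have : (k : ℝ) * j / N ≤ k * m := by
                    rw [div_le_iff₀ hN']
                    calc (k : ℝ) * j ≤ N * (k * m) := by gcongr
                      _ = _ := by ring
                  calc _ = k * -((n : ℝ) / N) + (k : ℝ) * j / N := by ring
                    _ ≤ _ := by rw [mul_add]; gcongr
          have h2 : (n.descFactorial j : ℝ) ≤ (n : ℝ) ^ j := by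
            exact_mod_cast Nat.descFactorial_le_pow n j
          calc _ ≤ ((truncExp m) ^ k).coeff j * (n : ℝ) ^ j *
                ((Real.exp (-((n : ℝ) / N)) * Real.exp m) ^ k / (N : ℝ) ^ j) := by gcongr
            _ = _ := by rw [div_pow]; ring
        · refine Finset.sum_nonneg fun j _ => ?_
          have := coeff_truncExp_pow_nonneg m k j
          have : (0 : ℝ) ≤ (N : ℝ) - k := sub_nonneg.2 hk
          positivity
    _ = _ := by
        rw [Finset.mul_sum, Finset.sum_div]
        refine Finset.sum_congr rfl fun j _ => ?_
        rw [mul_pow, mul_pow, mul_pow]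
        ring

open Topology Asymptotics

theorem tendsto_descFactorial_div_pow (j : ℕ) :
    Tendsto (fun n : ℕ => (n.descFactorial j : ℝ) / (n : ℝ) ^ j) atTop (𝓝 1) := by
  refine (isEquivalent_iff_tendsto_one ?_).1 (isEquivalent_descFactorial j)
  filter_upwards [eventually_gt_atTop 0] with n hn
  positivity

theorem tendsto_one_sub_mul_exp_pow {n : ℕ → ℕ} (k : ℕ)
    (hn : Tendsto (fun N : ℕ => (n N : ℝ) / (N : ℝ) ^ 2) atTop (𝓝 0)) :
    Tendsto (fun N : ℕ => ((1 - (k : ℝ) / N) * Real.exp ((k : ℝ) / N)) ^ n N) atTop (𝓝 1) := by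
  have h0 : Tendsto (fun N : ℕ => 1 - (k : ℝ) ^ 2 * ((n N : ℝ) / (N : ℝ) ^ 2)) atTop (𝓝 1) := by
    simpa using (hn.const_mul ((k : ℝ) ^ 2)).const_sub 1
  refine tendsto_of_tendsto_of_tendsto_of_le_of_le' h0 tendsto_const_nhds ?_ ?_
  all_goals
    filter_upwards [eventually_gt_atTop 0, eventually_ge_atTop k] with N hN hk
    have hN' : (0 : ℝ) < N := by exact_mod_cast hN
    have hk0 : (0 : ℝ) ≤ (k : ℝ) / N := by positivity
    have hk1 : (k : ℝ) / N ≤ 1 := (div_le_one hN').2 (by exact_mod_cast hk)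
  · calc 1 - (k : ℝ) ^ 2 * ((n N : ℝ) / (N : ℝ) ^ 2)
        = 1 + (n N : ℝ) * -((k : ℝ) / N) ^ 2 := by ring
      _ ≤ (1 + -((k : ℝ) / N) ^ 2) ^ n N := one_add_mul_le_pow (by nlinarith) _
      _ = ((1 - (k : ℝ) / N) * (k / N + 1)) ^ n N := by ring
      _ ≤ _ := by
        have := sub_nonneg.2 hk1
        gcongr
        exact Real.add_one_le_exp _
  · refine pow_le_one₀ (mul_nonneg (sub_nonneg.2 hk1) (Real.exp_nonneg _)) ?_
    calc _ ≤ Real.exp (-((k : ℝ) / N)) * Real.exp ((k : ℝ) / N) := by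
          gcongr; exact Real.one_sub_le_exp_neg _
      _ = 1 := by rw [← Real.exp_add]; simp

theorem tendsto_sieveTerm {n : ℕ → ℕ} {m : ℕ} {l : ℝ} (k : ℕ) (hn : Tendsto n atTop atTop)
    (hn2 : Tendsto (fun N : ℕ => (n N : ℝ) / (N : ℝ) ^ 2) atTop (𝓝 0))
    (hl : Tendsto (fun N : ℕ =>
      N * Real.exp (-((n N : ℝ) / N)) * (truncExp m).eval ((n N : ℝ) / N)) atTop (𝓝 l)) :
    Tendsto (fun N => sieveTerm m (n N) N k) atTop (𝓝 (l ^ k / k.factorial)) := by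
  set b : ℕ → ℕ → ℝ := fun j N => ((truncExp m) ^ k).coeff j * ((n N : ℝ) / N) ^ j *
    (N * Real.exp (-((n N : ℝ) / N))) ^ k with hb
  set r : ℕ → ℕ → ℝ := fun j N => ((N.descFactorial k : ℝ) / (N : ℝ) ^ k) *
    (((n N).descFactorial j : ℝ) / (n N : ℝ) ^ j) *
    (((1 - (k : ℝ) / N) * Real.exp ((k : ℝ) / N)) ^ n N / (1 - (k : ℝ) / N) ^ j) with hr
  have hb0 (j N : ℕ) : 0 ≤ b j N := by
    have := coeff_truncExp_pow_nonneg m k j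
    simp only [hb]; positivity
  have hsum : Tendsto (fun N => ∑ j ∈ Finset.range (k * m + 1), b j N) atTop (𝓝 (l ^ k)) := by
    simp only [hb, eval_mul_pow_truncExp]
    exact hl.pow k
  have hr1 (j : ℕ) : Tendsto (r j) atTop (𝓝 1) := by
    have h1 : Tendsto (fun N : ℕ => (1 - (k : ℝ) / N) ^ j) atTop (𝓝 1) := by
      simpa using ((tendsto_const_div_atTop_nhds_zero_nat (k : ℝ)).const_sub 1).pow j
    simpa using ((tendsto_descFactorial_div_pow k).mul
      ((tendsto_descFactorial_div_pow j).comp hn)).mul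
      ((tendsto_one_sub_mul_exp_pow k hn2).div h1 one_ne_zero)
  have hbr (j : ℕ) (hj : j ∈ Finset.range (k * m + 1)) :
      Tendsto (fun N => b j N * (r j N - 1)) atTop (𝓝 0) := by
    have h1 : Tendsto (fun N => r j N - 1) atTop (𝓝 0) := by simpa using (hr1 j).sub_const 1
    have hbO : b j =O[atTop] fun _ => (1 : ℝ) := by
      refine (IsBigO.of_bound 1 (Eventually.of_forall fun N => ?_)).trans (hsum.isBigO_one ℝ)
      rw [one_mul, Real.norm_of_nonneg (hb0 j N),
        Real.norm_of_nonneg (Finset.sum_nonneg fun i _ => hb0 i N)]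
      exact Finset.single_le_sum (f := fun i => b i N) (fun i _ => hb0 i N) hj
    simpa using hbO.mul_isLittleO ((isLittleO_one_iff ℝ).2 h1)
  have hfin := (hsum.add (tendsto_finsetSum _ hbr)).div_const (k.factorial : ℝ)
  rw [Finset.sum_const_zero, add_zero] at hfin
  refine hfin.congr' ?_
  filter_upwards [eventually_gt_atTop k, hn.eventually_gt_atTop (k * m + 1)] with N hN hnN
  have hN0 : 0 < N := by omega
  have hN' : (0 : ℝ) < N := by exact_mod_cast hN0
  have hn' : (0 : ℝ) < n N := by exact_mod_cast (by omega : 0 < n N)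
  have hk1 : (1 - (k : ℝ) / N) ≠ 0 :=
    (sub_pos.2 ((div_lt_one hN').2 (by exact_mod_cast hN))).ne'
  rw [← Finset.sum_add_distrib, sieveTerm, Finset.mul_sum, Finset.sum_div]
  refine Finset.sum_congr rfl fun j hj => ?_
  have hjn : j ≤ n N := by rw [Finset.mem_range] at hj; omega
  rw [mul_div_assoc _ (_ ^ _), sub_pow_div_pow_eq hN0 hjn, pow_sub₀ _ hk1 hjn]
  have he : Real.exp ((k : ℝ) / N) ^ n N * Real.exp (-((n N : ℝ) / N)) ^ k = 1 := by
    rw [← Real.exp_nat_mul, ← Real.exp_nat_mul, ← Real.exp_add, Real.exp_eq_one_iff]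
    ring
  have hf : (k.factorial : ℝ) ≠ 0 := by positivity
  calc _ = b j N * r j N / k.factorial := by ring
    _ = ((truncExp m) ^ k).coeff j * ((N.descFactorial k : ℝ) / k.factorial) *
        (n N).descFactorial j * ((1 - (k : ℝ) / N) ^ n N / (1 - (k : ℝ) / N) ^ j / (N : ℝ) ^ j) *
        (Real.exp ((k : ℝ) / N) ^ n N * Real.exp (-((n N : ℝ) / N)) ^ k) := by
      simp only [hb, hr, mul_pow, div_pow _ (N : ℝ) j]
      generalize (1 - (k : ℝ) / N) = s at *
      field_simp
    _ = _ := by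
      rw [he, Nat.descFactorial_eq_factorial_mul_choose]
      push_cast
      field_simp

/-- If the expected number of urns with fewer than `m` balls tends to `l`, in its Poisson
approximation, then the inclusion-exclusion sum tends to `exp (-l)`. -/
theorem tendsto_tsum_sieveTerm {n : ℕ → ℕ} {m : ℕ} {l : ℝ} (hn : Tendsto n atTop atTop)
    (hn2 : Tendsto (fun N : ℕ => (n N : ℝ) / (N : ℝ) ^ 2) atTop (𝓝 0))
    (hl : Tendsto (fun N : ℕ =>
      N * Real.exp (-((n N : ℝ) / N)) * (truncExp m).eval ((n N : ℝ) / N)) atTop (𝓝 l)) :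
    Tendsto (fun N => ∑' k : ℕ, (-1) ^ k * sieveTerm m (n N) N k) atTop
      (𝓝 (Real.exp (-l))) := by
  have he : Real.exp (-l) = ∑' k : ℕ, (-1) ^ k * (l ^ k / k.factorial) := by
    rw [Real.exp_eq_exp_ℝ, ← (NormedSpace.expSeries_div_hasSum_exp (-l)).tsum_eq]
    refine tsum_congr fun k => ?_
    rw [neg_pow, mul_div_assoc]
  rw [he]
  refine tendsto_tsum_of_dominated_convergence
    (bound := fun k => (Real.exp m * (l + 1)) ^ k / k.factorial)
    (Real.summable_pow_div_factorial _) (fun k => (tendsto_sieveTerm k hn hn2 hl).const_mul _) ?_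
  filter_upwards [eventually_gt_atTop 0, hl.eventually_le_const (lt_add_one l)] with N hN hlN k
  rw [norm_mul, norm_pow, norm_neg, norm_one, one_pow, one_mul,
    Real.norm_of_nonneg (sieveTerm_nonneg _ _ _ _)]
  refine (sieveTerm_le hN).trans ?_
  have : 0 ≤ (truncExp m).eval ((n N : ℝ) / N) := by rw [eval_truncExp]; positivity
  gcongr

theorem tendsto_log_natCast_atTop : Tendsto (fun N : ℕ => Real.log N) atTop atTop :=
  Real.tendsto_log_atTop.comp tendsto_natCast_atTop_atTop

/-- The real number `N log N + p N log log N + N x`, divided by `N`. -/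
noncomputable def erLoad (p : ℕ) (x : ℝ) (N : ℕ) : ℝ :=
  Real.log N + p * Real.log (Real.log N) + x

theorem erBalls_succ (p : ℕ) (x : ℝ) (N : ℕ) : erBalls (p + 1) x N = ⌊N * erLoad p x N⌋₊ := by
  rw [erBalls, erLoad]; push_cast; congr 1; ring

theorem tendsto_erLoad_div_log (p : ℕ) (x : ℝ) :
    Tendsto (fun N : ℕ => erLoad p x N / Real.log N) atTop (𝓝 1) := by
  have h1 : Tendsto (fun N : ℕ => Real.log (Real.log N) / Real.log N) atTop (𝓝 0) :=
    Real.isLittleO_log_id_atTop.tendsto_div_nhds_zero.comp tendsto_log_natCast_atTop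
  have h2 : Tendsto (fun N : ℕ => x / Real.log N) atTop (𝓝 0) :=
    tendsto_log_natCast_atTop.const_div_atTop x
  have h3 := ((h1.const_mul (p : ℝ)).const_add 1).add h2
  rw [mul_zero, add_zero, add_zero] at h3
  refine h3.congr' ?_
  filter_upwards [tendsto_log_natCast_atTop.eventually_gt_atTop 0] with N hN
  rw [erLoad]
  field_simp

theorem tendsto_erLoad_atTop (p : ℕ) (x : ℝ) : Tendsto (erLoad p x) atTop atTop := by
  refine ((tendsto_erLoad_div_log p x).pos_mul_atTop one_pos tendsto_log_natCast_atTop).congr' ?_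
  filter_upwards [tendsto_log_natCast_atTop.eventually_gt_atTop 0] with N hN
  exact div_mul_cancel₀ _ hN.ne'

theorem tendsto_erBalls_atTop (p : ℕ) (x : ℝ) : Tendsto (erBalls (p + 1) x) atTop atTop := by
  rw [funext (erBalls_succ p x)]
  exact tendsto_nat_floor_atTop.comp
    (tendsto_natCast_atTop_atTop.atTop_mul_atTop₀ (tendsto_erLoad_atTop p x))

theorem tendsto_erBalls_div_sub_erLoad (p : ℕ) (x : ℝ) :
    Tendsto (fun N : ℕ => (erBalls (p + 1) x N : ℝ) / N - erLoad p x N) atTop (𝓝 0) := by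
  refine squeeze_zero_norm' ?_ tendsto_one_div_atTop_nhds_zero_nat
  filter_upwards [eventually_gt_atTop 0, (tendsto_erLoad_atTop p x).eventually_ge_atTop 0]
    with N hN hx
  have hN' : (0 : ℝ) < N := by exact_mod_cast hN
  have h1 := Nat.floor_le (mul_nonneg hN'.le hx)
  have h2 := Nat.lt_floor_add_one (N * erLoad p x N)
  rw [erBalls_succ, Real.norm_eq_abs, abs_le, div_sub' hN'.ne', ← neg_div,
    div_le_div_iff_of_pos_right hN', div_le_div_iff_of_pos_right hN']
  constructor <;> linarith

theorem tendsto_erBalls_div_div_log (p : ℕ) (x : ℝ) :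
    Tendsto (fun N : ℕ => (erBalls (p + 1) x N : ℝ) / N / Real.log N) atTop (𝓝 1) := by
  have h := ((tendsto_erBalls_div_sub_erLoad p x).div_atTop tendsto_log_natCast_atTop).add
    (tendsto_erLoad_div_log p x)
  rw [zero_add] at h
  refine h.congr fun N => ?_
  rw [← add_div, sub_add_cancel]

theorem tendsto_erBalls_div_sq (p : ℕ) (x : ℝ) :
    Tendsto (fun N : ℕ => (erBalls (p + 1) x N : ℝ) / (N : ℝ) ^ 2) atTop (𝓝 0) := by
  have h1 : Tendsto (fun N : ℕ => Real.log N / N) atTop (𝓝 0) :=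
    Real.isLittleO_log_id_atTop.tendsto_div_nhds_zero.comp tendsto_natCast_atTop_atTop
  have h := (tendsto_erBalls_div_div_log p x).mul h1
  rw [mul_zero] at h
  refine h.congr' ?_
  filter_upwards [tendsto_log_natCast_atTop.eventually_gt_atTop 0] with N hN
  field_simp

/-- The Poisson approximation of the expected number of urns with at most `p` balls converges. -/
theorem tendsto_expected_light_urns (p : ℕ) (x : ℝ) :
    Tendsto (fun N : ℕ => N * Real.exp (-((erBalls (p + 1) x N : ℝ) / N)) *
      (truncExp (p + 1)).eval ((erBalls (p + 1) x N : ℝ) / N)) atTop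
      (𝓝 (Real.exp (-x) / p.factorial)) := by
  have hpow (i : ℕ) (hi : i ∈ Finset.range (p + 1)) :
      Tendsto (fun N : ℕ => Real.log N ^ i / Real.log N ^ p) atTop
        (𝓝 (if i = p then 1 else 0)) := by
    split_ifs with h
    · subst h
      refine tendsto_const_nhds.congr' ?_
      filter_upwards [tendsto_log_natCast_atTop.eventually_gt_atTop 0] with N hN
      rw [div_self (by positivity)]
    · exact (tendsto_pow_div_pow_atTop_zero
        (lt_of_le_of_ne (by rw [Finset.mem_range] at hi; omega) h)).comp tendsto_log_natCast_atTop
  have hexp : Tendsto (fun N : ℕ =>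
      Real.exp (-x - ((erBalls (p + 1) x N : ℝ) / N - erLoad p x N))) atTop
      (𝓝 (Real.exp (-x))) := by
    simpa using ((tendsto_erBalls_div_sub_erLoad p x).const_sub (-x)).rexp
  have h := tendsto_finsetSum (Finset.range (p + 1)) fun i hi =>
    (hexp.mul (hpow i hi)).mul
      (((tendsto_erBalls_div_div_log p x).pow i).div_const (i.factorial : ℝ))
  have hs : ∑ i ∈ Finset.range (p + 1),
      Real.exp (-x) * (if i = p then 1 else 0) * (1 ^ i / (i.factorial : ℝ)) =
      Real.exp (-x) / p.factorial := by
    rw [Finset.sum_eq_single_of_mem p (Finset.self_mem_range_succ p) fun i _ hi => by simp [hi]]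
    simp [div_eq_mul_inv]
  rw [hs] at h
  refine h.congr' ?_
  filter_upwards [eventually_gt_atTop 0, tendsto_log_natCast_atTop.eventually_gt_atTop 0]
    with N hN hL
  have hN' : (0 : ℝ) < N := by exact_mod_cast hN
  generalize (erBalls (p + 1) x N : ℝ) / N = a
  have e : Real.exp (-x - (a - erLoad p x N)) = N * Real.exp (-a) * Real.log N ^ p := by
    have h1 : -x - (a - erLoad p x N) = Real.log N + -a + p * Real.log (Real.log N) := by
      rw [erLoad]; ring
    rw [h1, Real.exp_add, Real.exp_add, Real.exp_log hN', Real.exp_nat_mul, Real.exp_log hL]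
  rw [eval_truncExp, Finset.mul_sum]
  refine Finset.sum_congr rfl fun i _ => ?_
  rw [e, div_pow]
  field_simp

open Classical in
/-- Erdős–Rényi generalized coupon collector theorem: placing
`⌊N log N + (m−1) N log log N + N x⌋` balls independently and uniformly into `N` urns,
the probability that every urn contains at least `m` balls tends to
`exp(−exp(−x)/(m−1)!)` as `N → ∞`. -/
theorem erdos_renyi_coupon_collector (m : ℕ) (hm : 1 ≤ m) (x : ℝ) :
    Tendsto (fun N : ℕ =>
        ((Finset.univ.filter (fun f : Fin (erBalls m x N) → Fin N =>
            ∀ u : Fin N, m ≤ (Finset.univ.filter (fun t => f t = u)).card)).card : ℝ)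
          / (N : ℝ) ^ (erBalls m x N))
      atTop (nhds (Real.exp (-Real.exp (-x) / (m - 1).factorial))) := by
  obtain ⟨p, rfl⟩ := Nat.exists_eq_add_of_le' hm
  simp only [card_allocations_div_eq_tsum, Nat.add_sub_cancel, neg_div]
  exact tendsto_tsum_sieveTerm (tendsto_erBalls_atTop p x) (tendsto_erBalls_div_sq p x)
    (tendsto_expected_light_urns p x)
end
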